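/- arXiv:2409.16286 — 2 statements merged into one kernel-verified Lean document; each statement's English description precedes it below -/
import Mathlib

section
/- Let p > 2, let I be an infinite set, and let Y be a finite-dimensional Banach space such that the dual Y* has modulus of convexity of power type q for some q with 2 ≤ q < p. Then the norm of the projective tensor product ℓ_p(I) ⊗̂_π Y is strongly subdifferentiable (SSD) at every point of its unit sphere. -/
open scoped ENNReal

/-- A Banach space `X` has modulus of convexity of power type `q ≥ 2` if there is `C > 0` such
that for all `ε ∈ (0,2]` and all `x, y` in the closed unit ball with `‖x - y‖ ≥ ε` one has
`1 - ‖x + y‖/2 ≥ C * ε ^ q`. -/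
def HasModulusOfConvexityPowerType (X : Type*) [SeminormedAddCommGroup X] (q : ℝ) : Prop :=
  ∃ C > (0 : ℝ), ∀ ε ∈ Set.Ioc (0 : ℝ) 2, ∀ x y : X,
    ‖x‖ ≤ 1 → ‖y‖ ≤ 1 → ε ≤ ‖x - y‖ → C * ε ^ q ≤ 1 - ‖x + y‖ / 2

/-- The set of all sums `Σ ‖u i‖ * ‖v i‖` over finite representations
`z = Σ u i ⊗ v i` of `z` as a sum of elementary tensors. -/
def projRepSums {X Y Z : Type*} [NormedAddCommGroup X] [NormedSpace ℝ X]
    [NormedAddCommGroup Y] [NormedSpace ℝ Y] [NormedAddCommGroup Z] [NormedSpace ℝ Z]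
    (tp : X →ₗ[ℝ] Y →ₗ[ℝ] Z) (z : Z) : Set ℝ :=
  { r | ∃ (k : ℕ) (u : Fin k → X) (v : Fin k → Y),
      z = ∑ i, tp (u i) (v i) ∧ r = ∑ i, ‖u i‖ * ‖v i‖ }

/-- The Banach space `Z`, together with the bilinear map `tp`, is (an isometric copy of) the
projective tensor product `X ⊗̂_π Y`: the span of the elementary tensors is dense in `Z`, and the
norm of any finite sum of elementary tensors is its projective norm, i.e. the infimum of
`Σ ‖u i‖ * ‖v i‖` over all finite representations. -/
structure IsProjectiveTensorProduct {X Y Z : Type*} [NormedAddCommGroup X] [NormedSpace ℝ X]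
    [NormedAddCommGroup Y] [NormedSpace ℝ Y] [NormedAddCommGroup Z] [NormedSpace ℝ Z]
    [CompleteSpace Z] (tp : X →ₗ[ℝ] Y →ₗ[ℝ] Z) : Prop where
  dense_span : Dense ((Submodule.span ℝ
    (Set.range fun xy : X × Y => tp xy.1 xy.2) : Submodule ℝ Z) : Set Z)
  norm_eq : ∀ (k : ℕ) (u : Fin k → X) (v : Fin k → Y),
    ‖∑ i, tp (u i) (v i)‖ = sInf (projRepSums tp (∑ i, tp (u i) (v i)))

/-- `z` is an SSD point of the unit sphere of `Z`: `‖z‖ = 1` and the one-sided limit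
`lim_{t → 0⁺} (‖z + t • h‖ - 1) / t` exists uniformly in `h` on the unit sphere of `Z`. -/
def IsSSDPoint {Z : Type*} [NormedAddCommGroup Z] [NormedSpace ℝ Z] (z : Z) : Prop :=
  ‖z‖ = 1 ∧ ∃ G : Z → ℝ, ∀ ε > (0 : ℝ), ∃ δ > (0 : ℝ), ∀ t : ℝ, 0 < t → t < δ →
    ∀ h : Z, ‖h‖ = 1 → |(‖z + t • h‖ - 1) / t - G h| < ε

open scoped Topology
open Filter

section LpSupport

variable {I : Type*} {r : ℝ≥0∞}

lemma lp_sum_single_apply [DecidableEq I] (A : Finset I) (x : I → ℝ) (j : I) :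
    (∑ i ∈ A, lp.single (E := fun _ : I => ℝ) r i (x i)) j = if j ∈ A then x j else 0 := by
  simp only [lp.coeFn_single, lp.coeFn_sum, Finset.sum_apply, Finset.sum_pi_single]

/-- `p`-additivity of the `ℓ_p` norm on vectors with disjoint supports, one of them finite. -/
lemma lp_norm_add_rpow_of_disjoint (hr : 0 < r.toReal)
    (A : Finset I) (u y : lp (fun _ : I => ℝ) r) (hu : ∀ i ∉ A, u i = 0) (hy : ∀ i ∈ A, y i = 0) :
    ‖u + y‖ ^ r.toReal = ‖u‖ ^ r.toReal + ‖y‖ ^ r.toReal := by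
  classical
  have hsum : ∑ i ∈ A, lp.single r i (u i) = u := by
    ext j
    rw [lp_sum_single_apply]
    split_ifs with hj
    · rfl
    · exact (hu j hj).symm
  have hcoord : ∀ i ∈ A, (u + y) i = u i := fun i hi => by simp [hy i hi]
  have h1 := lp.norm_compl_sum_single hr (u + y) A
  have h2 := lp.norm_sum_single (E := fun _ : I => ℝ) hr u A
  rw [Finset.sum_congr rfl fun i hi => by rw [hcoord i hi], hsum, add_sub_cancel_left,
    Finset.sum_congr rfl fun i hi => by rw [hcoord i hi]] at h1
  rw [hsum] at h2
  linarith

variable [Fact (1 ≤ r)]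

lemma lp_norm_sum_single_le [DecidableEq I] (hr : 0 < r.toReal)
    (A : Finset I) (x : lp (fun _ : I => ℝ) r) : ‖∑ i ∈ A, lp.single r i (x i)‖ ≤ ‖x‖ := by
  rw [← Real.rpow_le_rpow_iff (norm_nonneg _) (norm_nonneg _) hr, lp.norm_sum_single hr]
  have h := lp.norm_compl_sum_single hr x A
  have h0 : 0 ≤ ‖x - ∑ i ∈ A, lp.single r i (x i)‖ ^ r.toReal := by positivity
  linarith

lemma lp_norm_sub_sum_single_le [DecidableEq I] (hr : 0 < r.toReal)
    (A : Finset I) (x : lp (fun _ : I => ℝ) r) : ‖x - ∑ i ∈ A, lp.single r i (x i)‖ ≤ ‖x‖ := by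
  rw [← Real.rpow_le_rpow_iff (norm_nonneg _) (norm_nonneg _) hr, lp.norm_compl_sum_single hr]
  have h0 : 0 ≤ ∑ i ∈ A, ‖x i‖ ^ r.toReal := by positivity
  linarith

end LpSupport

/-- A contraction from `ℓ_p` into a space of convexity power type `q < p` that almost attains its
norm at a finitely supported vector is uniformly small on vectors supported off that set. -/
lemma HasModulusOfConvexityPowerType.exists_norm_apply_le {p q : ℝ} {r : ℝ≥0∞}
    [Fact (1 ≤ r)] (hr : r.toReal = p) (hp : 1 ≤ p) (hqp : q < p)
    {W : Type*} [NormedAddCommGroup W] [NormedSpace ℝ W]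
    (hW : HasModulusOfConvexityPowerType W q) (I : Type*) {κ : ℝ} (hκ : 0 < κ) :
    ∃ η > (0 : ℝ), ∀ (P : lp (fun _ : I => ℝ) r →ₗ[ℝ] W), (∀ x, ‖P x‖ ≤ ‖x‖) →
      ∀ (A : Finset I) (u y : lp (fun _ : I => ℝ) r), (∀ i ∉ A, u i = 0) →
        (∀ i ∈ A, y i = 0) → ‖u‖ ≤ 1 → 1 - η < ‖P u‖ → ‖y‖ ≤ 1 → ‖P y‖ ≤ κ := by
  obtain ⟨C, hC, hmod⟩ := hW
  set s : ℝ := min (1 / 2) (C * (2 * κ) ^ q / 4) with hs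
  have hs0 : 0 < s := by positivity
  set b : ℝ := s ^ (p - q)⁻¹ with hb
  have hb0 : 0 < b := by positivity
  have hpq : 0 < p - q := sub_pos.2 hqp
  have hb1 : b ≤ 1 := Real.rpow_le_one hs0.le ((min_le_left _ _).trans (by norm_num))
    (inv_nonneg.2 hpq.le)
  have hbs : b ^ (p - q) = s := Real.rpow_inv_rpow hs0.le hpq.ne'
  have hbp : b ^ p = b ^ q * s := by
    rw [← hbs, ← Real.rpow_add hb0]
    ring_nf
  have hbp0 : 0 < b ^ p := by positivity
  have hbp1 : b ^ p ≤ 1 := Real.rpow_le_one hb0.le hb1 (by linarith)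
  refine ⟨b ^ p, hbp0, fun P hP A u y hu hy hu1 hPu hy1 => ?_⟩
  by_contra! hlt
  have hκ1 : κ ≤ 1 := hlt.le.trans ((hP y).trans hy1)
  set a : ℝ := 1 - b ^ p with ha
  have ha0 : 0 ≤ a := by linarith
  have key : ∀ c : ℝ, |c| = b → ‖P (a • u) + P (c • y)‖ ≤ 1 := by
    intro c hc
    rw [← map_add]
    refine (hP _).trans ?_
    have hd := lp_norm_add_rpow_of_disjoint (by rw [hr]; linarith) A (a • u) (c • y)
      (fun i hi => by simp [hu i hi]) (fun i hi => by simp [hy i hi])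
    rw [hr, norm_smul, norm_smul, Real.norm_eq_abs, Real.norm_eq_abs, hc, abs_of_nonneg ha0] at hd
    have h1 : (a * ‖u‖) ^ p ≤ a := by
      calc (a * ‖u‖) ^ p ≤ a ^ p :=
            Real.rpow_le_rpow (by positivity) (mul_le_of_le_one_right ha0 hu1) (by linarith)
        _ ≤ a ^ (1 : ℝ) := Real.rpow_le_rpow_of_exponent_ge' ha0 (by linarith) (by norm_num) hp
        _ = a := Real.rpow_one a
    have h2 : (b * ‖y‖) ^ p ≤ b ^ p :=
      Real.rpow_le_rpow (by positivity) (mul_le_of_le_one_right hb0.le hy1) (by linarith)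
    rw [← Real.rpow_le_rpow_iff (norm_nonneg _) zero_le_one (by linarith : 0 < p), Real.one_rpow]
    linarith
  have k1 := key b (abs_of_pos hb0)
  have k2 := key (-b) (by rw [abs_neg, abs_of_pos hb0])
  have hdiff : P (a • u) + P (b • y) - (P (a • u) + P (-b • y)) = (2 * b) • P y := by
    simp only [map_smul]
    module
  have hsum : P (a • u) + P (b • y) + (P (a • u) + P (-b • y)) = (2 * a) • P u := by
    simp only [map_smul]
    module
  have hm := hmod (b * (2 * κ)) ⟨by positivity, by nlinarith⟩ _ _ k1 k2 (by
    rw [hdiff, norm_smul, Real.norm_eq_abs, abs_of_pos (by positivity)]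
    nlinarith)
  rw [hsum, norm_smul, Real.norm_eq_abs, abs_of_nonneg (by positivity),
    Real.mul_rpow hb0.le (by positivity)] at hm
  have hsle : 4 * s ≤ C * (2 * κ) ^ q := by
    have := min_le_right (1 / 2) (C * (2 * κ) ^ q / 4)
    linarith
  have hbq0 : 0 < b ^ q := by positivity
  have h4 : b ^ q * (4 * s) ≤ b ^ q * (C * (2 * κ) ^ q) := by gcongr
  have h5 : a * (1 - b ^ p) ≤ a * ‖P u‖ := by gcongr
  nlinarith

section TensorDualOperator

variable {X Y Z : Type*} [NormedAddCommGroup X] [NormedSpace ℝ X]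
    [NormedAddCommGroup Y] [NormedSpace ℝ Y] [FiniteDimensional ℝ Y]
    [NormedAddCommGroup Z] [NormedSpace ℝ Z] {tp : X →ₗ[ℝ] Y →ₗ[ℝ] Z}

/-- The operator `X → Y*` associated with a functional on a tensor product. -/
noncomputable def tensorDualOperator (tp : X →ₗ[ℝ] Y →ₗ[ℝ] Z) (f : Z →L[ℝ] ℝ) :
    X →ₗ[ℝ] (Y →L[ℝ] ℝ) :=
  LinearMap.toContinuousLinearMap.toLinearMap ∘ₗ tp.compr₂ (f : Z →ₗ[ℝ] ℝ)

@[simp]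
lemma tensorDualOperator_apply (f : Z →L[ℝ] ℝ) (u : X) (v : Y) :
    tensorDualOperator tp f u v = f (tp u v) := rfl

end TensorDualOperator

section ProjectiveTensorProduct

variable {X Y Z : Type*} [NormedAddCommGroup X] [NormedSpace ℝ X]
    [NormedAddCommGroup Y] [NormedSpace ℝ Y] [NormedAddCommGroup Z] [NormedSpace ℝ Z]
    [CompleteSpace Z] {tp : X →ₗ[ℝ] Y →ₗ[ℝ] Z}

lemma IsProjectiveTensorProduct.norm_apply_le (htp : IsProjectiveTensorProduct tp) (u : X) (v : Y) :
    ‖tp u v‖ ≤ ‖u‖ * ‖v‖ := by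
  have h := htp.norm_eq 1 (fun _ => u) (fun _ => v)
  simp only [Fin.sum_univ_one] at h
  rw [h]
  refine csInf_le ⟨0, ?_⟩ ⟨1, fun _ => u, fun _ => v, by simp, by simp⟩
  rintro _ ⟨k, u', v', -, rfl⟩
  positivity

lemma IsProjectiveTensorProduct.opNorm_le (htp : IsProjectiveTensorProduct tp) (f : Z →L[ℝ] ℝ)
    {c : ℝ} (hc : 0 ≤ c) (h : ∀ u v, |f (tp u v)| ≤ c * (‖u‖ * ‖v‖)) : ‖f‖ ≤ c := by
  refine f.opNorm_le_bound hc fun z => ?_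
  have hcl : IsClosed {z : Z | ‖f z‖ ≤ c * ‖z‖} :=
    isClosed_le (by fun_prop) (by fun_prop)
  refine hcl.closure_subset_iff.2 (fun w hw => ?_) (htp.dense_span z)
  have hrep : ∃ (k : ℕ) (u : Fin k → X) (v : Fin k → Y), w = ∑ i, tp (u i) (v i) := by
    obtain ⟨k, a, g, rfl⟩ := Submodule.mem_span_set'.1 hw
    choose xy hxy using fun i => (g i).2
    refine ⟨k, fun i => a i • (xy i).1, fun i => (xy i).2, Finset.sum_congr rfl fun i _ => ?_⟩
    simp [← hxy i]
  obtain ⟨k, u, v, hw'⟩ := hrep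
  have hnorm := htp.norm_eq k u v
  rw [← hw'] at hnorm
  have hbound : ∀ t ∈ projRepSums tp w, ‖f w‖ ≤ c * t := by
    rintro t ⟨m, u', v', hm, rfl⟩
    rw [hm, map_sum, Finset.mul_sum]
    exact (norm_sum_le _ _).trans (Finset.sum_le_sum fun i _ => h _ _)
  have hne : (projRepSums tp w).Nonempty := ⟨_, k, u, v, hw', rfl⟩
  change ‖f w‖ ≤ c * ‖w‖
  rcases hc.eq_or_lt with rfl | hc
  · obtain ⟨t, ht⟩ := hne
    simpa using hbound t ht
  · rw [hnorm, ← div_le_iff₀' hc]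
    exact le_csInf hne fun t ht => (div_le_iff₀' hc).2 (hbound t ht)

variable [FiniteDimensional ℝ Y]

lemma IsProjectiveTensorProduct.norm_tensorDualOperator_le (htp : IsProjectiveTensorProduct tp)
    (f : Z →L[ℝ] ℝ) (u : X) : ‖tensorDualOperator tp f u‖ ≤ ‖f‖ * ‖u‖ := by
  refine ContinuousLinearMap.opNorm_le_bound _ (by positivity) fun v => ?_
  rw [tensorDualOperator_apply, mul_assoc]
  exact (f.le_opNorm _).trans (by gcongr; exact htp.norm_apply_le u v)

lemma IsProjectiveTensorProduct.exists_lt_norm_tensorDualOperator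
    (htp : IsProjectiveTensorProduct tp) (f : Z →L[ℝ] ℝ) {c : ℝ} (hc : c < ‖f‖) :
    ∃ u : X, ‖u‖ ≤ 1 ∧ c < ‖tensorDualOperator tp f u‖ := by
  set T := (tensorDualOperator tp f).mkContinuous ‖f‖ (htp.norm_tensorDualOperator_le f)
  have hT : ‖f‖ ≤ ‖T‖ := by
    refine htp.opNorm_le f T.opNorm_nonneg fun u v => ?_
    calc |f (tp u v)| = ‖T u v‖ := rfl
      _ ≤ ‖T u‖ * ‖v‖ := (T u).le_opNorm v
      _ ≤ ‖T‖ * ‖u‖ * ‖v‖ := by gcongr; exact T.le_opNorm u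
      _ = ‖T‖ * (‖u‖ * ‖v‖) := mul_assoc _ _ _
  obtain ⟨u, hu, hu'⟩ := T.exists_lt_apply_of_lt_opNorm (hc.trans_le hT)
  exact ⟨u, hu.le, hu'⟩

end ProjectiveTensorProduct

/-- On the dual of a finite-dimensional space, pointwise convergence is norm convergence. -/
lemma tendsto_dual_of_tendsto_apply {Y α : Type*} [NormedAddCommGroup Y] [NormedSpace ℝ Y]
    [FiniteDimensional ℝ Y] {l : Filter α} {g : α → Y →L[ℝ] ℝ} {g₀ : Y →L[ℝ] ℝ}
    (h : ∀ v, Tendsto (fun a => g a v) l (𝓝 (g₀ v))) : Tendsto g l (𝓝 g₀) := by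
  let b := Module.finBasis ℝ Y
  have hrep : ∀ φ : Y →L[ℝ] ℝ,
      ∑ j, φ (b j) • LinearMap.toContinuousLinearMap (b.coord j) = φ := by
    intro φ
    ext v
    conv_rhs => rw [← b.sum_repr v, map_sum]
    simp [-Module.Basis.sum_repr, mul_comm]
  rw [← hrep g₀, ← funext fun a => hrep (g a)]
  exact tendsto_finsetSum _ fun j _ => (h (b j)).smul_const _

/-- Kadec–Klee property: on the dual of `ℓ_p ⊗̂_π Y`, pointwise convergence within the unit ball to
a functional of norm one is norm convergence. -/
lemma IsProjectiveTensorProduct.tendsto_of_tendsto_apply {p q : ℝ} {r : ℝ≥0∞} [Fact (1 ≤ r)]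
    (hr : r.toReal = p) (hp : 1 ≤ p) (hqp : q < p) {I Y Z α : Type*}
    [NormedAddCommGroup Y] [NormedSpace ℝ Y] [FiniteDimensional ℝ Y]
    (hY : HasModulusOfConvexityPowerType (Y →L[ℝ] ℝ) q)
    [NormedAddCommGroup Z] [NormedSpace ℝ Z] [CompleteSpace Z]
    {tp : lp (fun _ : I => ℝ) r →ₗ[ℝ] Y →ₗ[ℝ] Z}
    (htp : IsProjectiveTensorProduct tp) {l : Filter α} {f : α → Z →L[ℝ] ℝ} {f₀ : Z →L[ℝ] ℝ}
    (hf : ∀ a, ‖f a‖ ≤ 1) (hf₀ : ‖f₀‖ = 1) (h : ∀ z, Tendsto (fun a => f a z) l (𝓝 (f₀ z))) :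
    Tendsto f l (𝓝 f₀) := by
  classical
  have hr0 : 0 < r.toReal := by rw [hr]; linarith
  have hrtop : r ≠ ⊤ := by
    rintro rfl
    simp at hr0
  have hT : ∀ x, Tendsto (fun a => tensorDualOperator tp (f a) x) l
      (𝓝 (tensorDualOperator tp f₀ x)) :=
    fun x => tendsto_dual_of_tendsto_apply fun v => h (tp x v)
  have hcontr : ∀ g : Z →L[ℝ] ℝ, ‖g‖ ≤ 1 → ∀ x, ‖tensorDualOperator tp g x‖ ≤ ‖x‖ := fun g hg x =>
    (htp.norm_tensorDualOperator_le g x).trans (mul_le_of_le_one_left (norm_nonneg _) hg)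
  rw [Metric.tendsto_nhds]
  intro ε hε
  obtain ⟨η, hη, hsmall⟩ := hY.exists_norm_apply_le hr hp hqp I (κ := ε / 4) (by positivity)
  obtain ⟨u, A, hu1, huA, hu⟩ : ∃ (u : lp (fun _ : I => ℝ) r) (A : Finset I), ‖u‖ ≤ 1 ∧
      (∀ i ∉ A, u i = 0) ∧ 1 - η < ‖tensorDualOperator tp f₀ u‖ := by
    obtain ⟨x, hx1, hx⟩ := htp.exists_lt_norm_tensorDualOperator f₀ (c := 1 - η) (by linarith)
    have hcont : Continuous (tensorDualOperator tp f₀) :=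
      AddMonoidHomClass.continuous_of_bound _ 1 fun x => by
        simpa using hcontr f₀ hf₀.le x
    have hlim : Tendsto (fun A : Finset I =>
        ‖tensorDualOperator tp f₀ (∑ i ∈ A, lp.single r i (x i))‖) atTop
        (𝓝 ‖tensorDualOperator tp f₀ x‖) :=
      ((hcont.tendsto x).comp (lp.hasSum_single hrtop x)).norm
    obtain ⟨A, hA⟩ := (hlim.eventually_const_lt hx).exists
    refine ⟨_, A, (lp_norm_sum_single_le hr0 A x).trans hx1, fun i hi => ?_, hA⟩
    rw [lp_sum_single_apply, if_neg hi]
  have hev1 : ∀ᶠ a in l, 1 - η < ‖tensorDualOperator tp (f a) u‖ :=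
    (hT u).norm.eventually_const_lt hu
  have hev2 : ∀ᶠ a in l, ∑ i ∈ A, ‖tensorDualOperator tp (f a) (lp.single r i 1) -
      tensorDualOperator tp f₀ (lp.single r i 1)‖ < ε / 4 := by
    have : Tendsto (fun a => ∑ i ∈ A, ‖tensorDualOperator tp (f a) (lp.single r i 1) -
      tensorDualOperator tp f₀ (lp.single r i 1)‖) l (𝓝 (∑ i ∈ A, 0)) :=
      tendsto_finsetSum _ fun i _ => tendsto_iff_norm_sub_tendsto_zero.1 (hT _)
    rw [Finset.sum_const_zero] at this
    exact this.eventually_lt_const (by positivity)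
  filter_upwards [hev1, hev2] with a ha1 ha2
  have htail : ∀ y : lp (fun _ : I => ℝ) r, (∀ i ∈ A, y i = 0) →
      ‖tensorDualOperator tp (f a) y - tensorDualOperator tp f₀ y‖ ≤ ε / 2 * ‖y‖ := by
    intro y hy
    rcases eq_or_ne y 0 with rfl | hy0
    · simp
    have hn : 0 < ‖y‖ := norm_pos_iff.2 hy0
    have hbd : ∀ g : Z →L[ℝ] ℝ, ‖g‖ ≤ 1 → 1 - η < ‖tensorDualOperator tp g u‖ →
        ‖tensorDualOperator tp g y‖ ≤ ε / 4 * ‖y‖ := by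
      intro g hg hgu
      have := hsmall (tensorDualOperator tp g) (hcontr g hg) A u (‖y‖⁻¹ • y) huA
        (fun i hi => by simp [hy i hi]) hu1 hgu (by rw [norm_smul]; simp [hn.ne'])
      rw [map_smul, norm_smul, norm_inv, norm_norm, inv_mul_le_iff₀ hn] at this
      linarith
    have h1 := hbd (f a) (hf a) ha1
    have h2 := hbd f₀ hf₀.le hu
    have h3 := norm_sub_le (tensorDualOperator tp (f a) y) (tensorDualOperator tp f₀ y)
    linarith
  have hall : ∀ x : lp (fun _ : I => ℝ) r,
      ‖tensorDualOperator tp (f a) x - tensorDualOperator tp f₀ x‖ ≤ 3 * ε / 4 * ‖x‖ := by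
    intro x
    set y := x - ∑ i ∈ A, lp.single r i (x i) with hydef
    have hy : ∀ i ∈ A, y i = 0 := fun i hi => by
      rw [hydef, lp.coeFn_sub, Pi.sub_apply, lp_sum_single_apply, if_pos hi, sub_self]
    have hyx : ‖y‖ ≤ ‖x‖ := lp_norm_sub_sum_single_le hr0 A x
    have hx : x = ∑ i ∈ A, x i • lp.single r i (1 : ℝ) + y := by
      have : ∀ i, x i • lp.single (E := fun _ : I => ℝ) r i (1 : ℝ) = lp.single r i (x i) :=
        fun i => by rw [← lp.single_smul]; simp
      simp [this, hydef]
    have hsplit : tensorDualOperator tp (f a) x - tensorDualOperator tp f₀ x =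
        ∑ i ∈ A, x i • (tensorDualOperator tp (f a) (lp.single r i 1) -
          tensorDualOperator tp f₀ (lp.single r i 1)) +
        (tensorDualOperator tp (f a) y - tensorDualOperator tp f₀ y) := by
      conv_lhs => rw [hx]
      simp only [map_add, map_sum, map_smul, smul_sub, Finset.sum_sub_distrib]
      abel
    rw [hsplit]
    have hhead : ‖∑ i ∈ A, x i • (tensorDualOperator tp (f a) (lp.single r i 1) -
          tensorDualOperator tp f₀ (lp.single r i 1))‖ ≤ ε / 4 * ‖x‖ := by
      refine (norm_sum_le _ _).trans ?_
      calc _ ≤ ∑ i ∈ A, ‖x‖ * ‖tensorDualOperator tp (f a) (lp.single r i 1) -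
            tensorDualOperator tp f₀ (lp.single r i 1)‖ := by
            refine Finset.sum_le_sum fun i _ => ?_
            rw [norm_smul]
            gcongr
            exact lp.norm_apply_le_norm (ENNReal.toReal_pos_iff.1 hr0).1.ne' x i
        _ ≤ ‖x‖ * (ε / 4) := by rw [← Finset.mul_sum]; gcongr
        _ = ε / 4 * ‖x‖ := mul_comm _ _
    have h1 := htail y hy
    have h2 : ε / 2 * ‖y‖ ≤ ε / 2 * ‖x‖ := by gcongr
    refine (norm_add_le _ _).trans ?_
    linarith
  rw [dist_eq_norm]
  refine (htp.opNorm_le (f a - f₀) (c := 3 * ε / 4) (by positivity) fun x v => ?_).trans_lt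
    (by linarith)
  calc |(f a - f₀) (tp x v)| = ‖(tensorDualOperator tp (f a) x - tensorDualOperator tp f₀ x) v‖ :=
        rfl
    _ ≤ ‖tensorDualOperator tp (f a) x - tensorDualOperator tp f₀ x‖ * ‖v‖ :=
        ContinuousLinearMap.le_opNorm _ v
    _ ≤ 3 * ε / 4 * ‖x‖ * ‖v‖ := by gcongr; exact hall x
    _ = 3 * ε / 4 * (‖x‖ * ‖v‖) := mul_assoc _ _ _

section SSD

variable {Z : Type*} [NormedAddCommGroup Z] [NormedSpace ℝ Z]

/-- If functionals almost norming `z` are uniformly close to the face of functionals norming `z`,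
then the norm is strongly subdifferentiable at `z`. -/
lemma isSSDPoint_of_exists_norming_near {z : Z} (hz : ‖z‖ = 1)
    (H : ∀ ε > (0 : ℝ), ∃ δ > (0 : ℝ), ∀ f : Z →L[ℝ] ℝ, ‖f‖ ≤ 1 → 1 - δ < f z →
      ∃ g : Z →L[ℝ] ℝ, ‖g‖ ≤ 1 ∧ g z = 1 ∧ ‖f - g‖ < ε) : IsSSDPoint z := by
  set F : Set (Z →L[ℝ] ℝ) := {g | ‖g‖ ≤ 1 ∧ g z = 1} with hF
  have hle : ∀ g : Z →L[ℝ] ℝ, ‖g‖ ≤ 1 → ∀ x, g x ≤ ‖x‖ := fun g hg x =>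
    (le_abs_self _).trans ((g.le_opNorm x).trans (mul_le_of_le_one_left (norm_nonneg _) hg))
  have hne : F.Nonempty := by
    obtain ⟨g, hg, hgz⟩ := exists_dual_vector'' ℝ z
    exact ⟨g, hg, by simpa [hz] using hgz⟩
  have hbdd : ∀ x : Z, BddAbove ((fun g : Z →L[ℝ] ℝ => g x) '' F) := fun x =>
    ⟨‖x‖, by rintro _ ⟨g, hg, rfl⟩; exact hle g hg.1 x⟩
  refine ⟨hz, fun x => sSup ((fun g : Z →L[ℝ] ℝ => g x) '' F), fun ε hε => ?_⟩
  obtain ⟨δ, hδ, hH⟩ := H ε hε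
  refine ⟨δ / 2, by positivity, fun t ht htδ h hh => ?_⟩
  obtain ⟨f, hf, hfz⟩ := exists_dual_vector'' ℝ (z + t • h)
  replace hfz : f z + t * f h = ‖z + t • h‖ := by simpa using hfz
  have hfh : f h ≤ 1 := hh ▸ hle f hf h
  have hfz1 : f z ≤ 1 := hz ▸ hle f hf z
  have hlow : 1 - t ≤ ‖z + t • h‖ := by
    have := norm_sub_norm_le z (-(t • h))
    rw [sub_neg_eq_add, norm_neg, norm_smul, hh, hz, Real.norm_eq_abs, abs_of_pos ht] at this
    linarith
  obtain ⟨g, hg1, hgz, hfg⟩ := hH f hf (by nlinarith)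
  have hgh : g h ≤ sSup ((fun g : Z →L[ℝ] ℝ => g h) '' F) :=
    le_csSup (hbdd h) ⟨g, ⟨hg1, hgz⟩, rfl⟩
  have hfgh : f h - g h < ε := by
    calc f h - g h = (f - g) h := rfl
      _ ≤ ‖(f - g) h‖ := le_abs_self _
      _ ≤ ‖f - g‖ * ‖h‖ := (f - g).le_opNorm h
      _ < ε := by rwa [hh, mul_one]
  have hup : (‖z + t • h‖ - 1) / t ≤ f h := by
    rw [div_le_iff₀ ht]
    linarith
  have hdown : sSup ((fun g : Z →L[ℝ] ℝ => g h) '' F) ≤ (‖z + t • h‖ - 1) / t := by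
    refine csSup_le (hne.image _) ?_
    rintro _ ⟨k, hk, rfl⟩
    rw [le_div_iff₀ ht]
    have := hle k hk.1 (z + t • h)
    rw [map_add, map_smul, hk.2, smul_eq_mul] at this
    linarith
  rw [abs_lt]
  constructor <;> linarith

/-- A space whose dual has the weak-star Kadec–Klee property has an SSD norm. -/
lemma isSSDPoint_of_dual_kadecKlee {z : Z} (hz : ‖z‖ = 1)
    (H : ∀ (l : Ultrafilter ℕ) (f : ℕ → Z →L[ℝ] ℝ) (f₀ : Z →L[ℝ] ℝ), (∀ n, ‖f n‖ ≤ 1) → ‖f₀‖ = 1 →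
      (∀ x, Tendsto (fun n => f n x) l (𝓝 (f₀ x))) → Tendsto f l (𝓝 f₀)) : IsSSDPoint z := by
  refine isSSDPoint_of_exists_norming_near hz ?_
  by_contra! hcon
  obtain ⟨ε, hε, hcon⟩ := hcon
  choose f hf hfz hfar using fun n : ℕ => hcon (1 / ((n : ℝ) + 1)) (by positivity)
  have hmem : ∀ n, StrongDual.toWeakDual (f n) ∈
      (WeakDual.toStrongDual ⁻¹' Metric.closedBall (0 : StrongDual ℝ Z) 1) := fun n => by
    simpa using hf n
  obtain ⟨w, hw, hlim⟩ := (WeakDual.isCompact_closedBall (𝕜 := ℝ) (0 : StrongDual ℝ Z) 1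
    ).ultrafilter_le_nhds' ((hyperfilter ℕ).map fun n => StrongDual.toWeakDual (f n))
      (Ultrafilter.mem_map.2 (Eventually.of_forall hmem))
  set f₀ : Z →L[ℝ] ℝ := WeakDual.toStrongDual w with hf₀
  have hf₀1 : ‖f₀‖ ≤ 1 := by simpa using hw
  have hpt : ∀ x, Tendsto (fun n => f n x) (hyperfilter ℕ) (𝓝 (f₀ x)) := fun x =>
    ((WeakDual.eval_continuous x).tendsto w).comp (tendsto_iff_comap.2 (map_le_iff_le_comap.1 hlim))
  have hfz1 : Tendsto (fun n => f n z) (hyperfilter ℕ) (𝓝 1) := by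
    have h0 : Tendsto (fun n => f n z) atTop (𝓝 1) := by
      refine tendsto_of_tendsto_of_tendsto_of_le_of_le
        (g := fun n : ℕ => 1 - 1 / ((n : ℝ) + 1)) ?_ tendsto_const_nhds (fun n => (hfz n).le)
        fun n => ?_
      · simpa using tendsto_one_div_add_atTop_nhds_zero_nat.const_sub (1 : ℝ)
      · exact (le_abs_self _).trans (((f n).le_opNorm z).trans (by rw [hz, mul_one]; exact hf n))
    exact h0.mono_left Nat.hyperfilter_le_atTop
  have hf₀z : f₀ z = 1 := tendsto_nhds_unique (hpt z) hfz1
  have hf₀n : ‖f₀‖ = 1 := by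
    refine le_antisymm hf₀1 ?_
    have := f₀.le_opNorm z
    rwa [hf₀z, hz, mul_one, norm_one] at this
  have hnorm := H (hyperfilter ℕ) f f₀ hf hf₀n hpt
  obtain ⟨n, hn⟩ := ((Metric.tendsto_nhds.1 hnorm) ε hε).exists
  rw [dist_eq_norm] at hn
  exact (hfar n f₀ hf₀1 hf₀z).not_gt hn

end SSD

/-- **Theorem 3.3.** Let `p > 2`, let `I` be an infinite set and let `Y` be a finite-dimensional
Banach space whose dual has modulus of convexity of power type `q` for some `2 ≤ q < p`. Then the
norm of `ℓ_p(I) ⊗̂_π Y` is SSD at every point of its unit sphere. -/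
theorem ssd_of_projectiveTensorProduct_lp
    (p q : ℝ) (hp : 2 < p) (hq : 2 ≤ q) (hqp : q < p)
    (I : Type*) [Infinite I] [Fact (1 ≤ ENNReal.ofReal p)]
    (Y : Type*) [NormedAddCommGroup Y] [NormedSpace ℝ Y] [FiniteDimensional ℝ Y]
    (hY : HasModulusOfConvexityPowerType (Y →L[ℝ] ℝ) q)
    (Z : Type*) [NormedAddCommGroup Z] [NormedSpace ℝ Z] [CompleteSpace Z]
    (tp : lp (fun _ : I => ℝ) (ENNReal.ofReal p) →ₗ[ℝ] Y →ₗ[ℝ] Z)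
    (htp : IsProjectiveTensorProduct tp) :
    ∀ z : Z, ‖z‖ = 1 → IsSSDPoint z := by
  intro z hz
  exact isSSDPoint_of_dual_kadecKlee hz fun l f f₀ hf hf₀ h =>
    htp.tendsto_of_tendsto_apply (ENNReal.toReal_ofReal (by linarith)) (by linarith) hqp hY
      hf hf₀ h
end

section
/- Let I be an infinite set and let Y be a finite-dimensional smooth Banach space. Then the dual of the projective tensor product c_0(I) ⊗̂_π Y has the w*-Kadec–Klee property. -/
open scoped Topology

/-- A Banach space `Y` is smooth if every point of its unit sphere has a unique norming
functional. -/
def SmoothNormedSpace (Y : Type*) [NormedAddCommGroup Y] [NormedSpace ℝ Y] : Prop :=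
  ∀ y : Y, ‖y‖ = 1 → ∃! f : Y →L[ℝ] ℝ, ‖f‖ = 1 ∧ f y = 1

/-- The dual of `Z` has the `w*`-Kadec–Klee property: every net in the unit sphere of `Z*`
converging weak* to an element of the unit sphere converges to it in norm. -/
def WStarKadecKlee (Z : Type*) [NormedAddCommGroup Z] [NormedSpace ℝ Z] : Prop :=
  ∀ {ι : Type*} (l : Filter ι) [l.NeBot] (φ : ι → Z →L[ℝ] ℝ) (f : Z →L[ℝ] ℝ),
    (∀ s, ‖φ s‖ = 1) → ‖f‖ = 1 →
    (∀ z : Z, Filter.Tendsto (fun s => φ s z) l (𝓝 (f z))) →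
    Filter.Tendsto (fun s => ‖φ s - f‖) l (𝓝 0)

/-- If the unit vector `y₀` has a unique norming functional, then the norm of a finite-dimensional
space has vanishing symmetric second difference quotient at `y₀`. -/
lemma SmoothNormedSpace.exists_norm_add_norm_sub_le {Y : Type*} [NormedAddCommGroup Y]
    [NormedSpace ℝ Y] [FiniteDimensional ℝ Y] (hY : SmoothNormedSpace Y) {y₀ : Y}
    (hy₀ : ‖y₀‖ = 1) (y : Y) {η : ℝ} (hη : 0 < η) :
    ∃ t : ℝ, 0 < t ∧ ‖y₀ + t • y‖ + ‖y₀ - t • y‖ ≤ 2 + η * t := by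
  by_contra! hcon
  have : ProperSpace (Y →L[ℝ] ℝ) := FiniteDimensional.proper ℝ _
  set t : ℕ → ℝ := fun n => 1 / ((n : ℝ) + 1) with ht
  have htpos : ∀ n, 0 < t n := fun n => by positivity
  have htlim : Filter.Tendsto t Filter.atTop (𝓝 0) := tendsto_one_div_add_atTop_nhds_zero_nat
  choose a ha1 ha2 using fun n => exists_dual_vector'' ℝ (y₀ + t n • y)
  choose b hb1 hb2 using fun n => exists_dual_vector'' ℝ (y₀ - t n • y)
  simp only [RCLike.ofReal_real_eq_id, id_eq] at ha2 hb2
  obtain ⟨⟨p, q⟩, hpq, k, hk, hlim⟩ :=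
    ((isCompact_closedBall (0 : Y →L[ℝ] ℝ) 1).prod
      (isCompact_closedBall (0 : Y →L[ℝ] ℝ) 1)).tendsto_subseq
      (x := fun n => (a n, b n)) (fun n => by simp [ha1 n, hb1 n])
  have hp1 : ‖p‖ ≤ 1 := by simpa using hpq.1
  have hq1 : ‖q‖ ≤ 1 := by simpa using hpq.2
  have hap : Filter.Tendsto (fun n => a (k n)) Filter.atTop (𝓝 p) :=
    (continuous_fst.tendsto (p, q)).comp hlim
  have hbq : Filter.Tendsto (fun n => b (k n)) Filter.atTop (𝓝 q) :=
    (continuous_snd.tendsto (p, q)).comp hlim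
  have htk : Filter.Tendsto (fun n => t (k n)) Filter.atTop (𝓝 0) :=
    htlim.comp hk.tendsto_atTop
  have hplus : Filter.Tendsto (fun n => y₀ + t (k n) • y) Filter.atTop (𝓝 y₀) := by
    simpa using tendsto_const_nhds.add (htk.smul_const y)
  have hminus : Filter.Tendsto (fun n => y₀ - t (k n) • y) Filter.atTop (𝓝 y₀) := by
    simpa using tendsto_const_nhds.sub (htk.smul_const y)
  have apply_lim : ∀ {r : ℕ → Y →L[ℝ] ℝ} {r₀ : Y →L[ℝ] ℝ} {w : ℕ → Y} {w₀ : Y},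
      Filter.Tendsto r Filter.atTop (𝓝 r₀) → Filter.Tendsto w Filter.atTop (𝓝 w₀) →
      Filter.Tendsto (fun n => r n (w n)) Filter.atTop (𝓝 (r₀ w₀)) := fun hr hw =>
    (isBoundedBilinearMap_apply.continuous.tendsto (_, _)).comp (hr.prodMk_nhds hw)
  have hpy : p y₀ = 1 := by
    refine tendsto_nhds_unique (apply_lim hap hplus) ?_
    simpa only [ha2, hy₀] using hplus.norm
  have hqy : q y₀ = 1 := by
    refine tendsto_nhds_unique (apply_lim hbq hminus) ?_
    simpa only [hb2, hy₀] using hminus.norm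
  have norm_eq_one : ∀ r : Y →L[ℝ] ℝ, ‖r‖ ≤ 1 → r y₀ = 1 → ‖r‖ = 1 := fun r hr hry => by
    have h := r.le_opNorm y₀
    rw [hry, hy₀, norm_one, mul_one] at h
    exact le_antisymm hr h
  have hpq' : p = q :=
    (hY y₀ hy₀).unique ⟨norm_eq_one p hp1 hpy, hpy⟩ ⟨norm_eq_one q hq1 hqy, hqy⟩
  have hdiff : Filter.Tendsto (fun n => a (k n) y - b (k n) y) Filter.atTop (𝓝 0) := by
    have h := (apply_lim hap (tendsto_const_nhds (x := y))).sub
      (apply_lim hbq (tendsto_const_nhds (x := y)))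
    rwa [hpq', sub_self] at h
  obtain ⟨n, hn⟩ := (hdiff.eventually (gt_mem_nhds hη)).exists
  have h := hcon (t (k n)) (htpos _)
  rw [← ha2, ← hb2, map_add, map_sub, map_smul, map_smul, smul_eq_mul, smul_eq_mul] at h
  have ha3 : a (k n) y₀ ≤ 1 := by
    simpa [hy₀] using (le_abs_self _).trans ((a (k n)).le_of_opNorm_le (ha1 _) y₀)
  have hb3 : b (k n) y₀ ≤ 1 := by
    simpa [hy₀] using (le_abs_self _).trans ((b (k n)).le_of_opNorm_le (hb1 _) y₀)
  nlinarith [htpos (k n)]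

section TensorNorm

variable {X Y Z : Type*} [NormedAddCommGroup X] [NormedSpace ℝ X]
  [NormedAddCommGroup Y] [NormedSpace ℝ Y] [NormedAddCommGroup Z] [NormedSpace ℝ Z]
  [CompleteSpace Z] {tp : X →ₗ[ℝ] Y →ₗ[ℝ] Z}

lemma IsProjectiveTensorProduct.norm_tp_le (htp : IsProjectiveTensorProduct tp) (x : X) (y : Y) :
    ‖tp x y‖ ≤ ‖x‖ * ‖y‖ := by
  have h := htp.norm_eq 1 (fun _ => x) (fun _ => y)
  simp only [Finset.univ_unique, Finset.sum_singleton] at h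
  rw [h]
  refine csInf_le ⟨0, ?_⟩ ⟨1, fun _ => x, fun _ => y, by simp, by simp⟩
  rintro _ ⟨k, u, v, -, rfl⟩
  positivity

/-- A functional on the projective tensor product is bounded by any bound for the associated
bilinear form. -/
lemma IsProjectiveTensorProduct.opNorm_le_s6 (htp : IsProjectiveTensorProduct tp) (φ : Z →L[ℝ] ℝ)
    {C : ℝ} (hC : 0 ≤ C) (h : ∀ x y, |φ (tp x y)| ≤ C * (‖x‖ * ‖y‖)) : ‖φ‖ ≤ C := by
  refine φ.opNorm_le_bound hC fun z => ?_
  refine htp.dense_span.induction (P := fun z => ‖φ z‖ ≤ C * ‖z‖) ?_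
    (isClosed_le (by fun_prop) (by fun_prop)) z
  intro z hz
  obtain ⟨k, u, v, rfl⟩ : ∃ (k : ℕ) (u : Fin k → X) (v : Fin k → Y),
      z = ∑ i, tp (u i) (v i) := by
    obtain ⟨k, c, g, rfl⟩ := Submodule.mem_span_set'.1 hz
    choose w hw using fun i => (g i).2
    exact ⟨k, fun i => c i • (w i).1, fun i => (w i).2, by simp [← hw]⟩
  rw [htp.norm_eq]
  obtain rfl | hC := hC.eq_or_lt
  · have h0 : ∀ x y, φ (tp x y) = 0 := by simpa using h
    simp [h0]
  rw [← div_le_iff₀' hC]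
  refine le_csInf ⟨_, k, u, v, rfl, rfl⟩ ?_
  rintro _ ⟨m, u', v', hz', rfl⟩
  rw [div_le_iff₀' hC, hz', map_sum, Finset.mul_sum]
  exact (norm_sum_le _ _).trans (Finset.sum_le_sum fun i _ => h _ _)

/-- If `Y` is finite-dimensional, the bilinear form of a functional of norm one almost attains its
norm along a fixed unit vector of `Y`. -/
lemma IsProjectiveTensorProduct.exists_norming [FiniteDimensional ℝ Y]
    (htp : IsProjectiveTensorProduct tp) (f : Z →L[ℝ] ℝ) (hf : ‖f‖ = 1) :
    ∃ y₀ : Y, ‖y₀‖ = 1 ∧ ∀ ε > 0, ∃ x : X, ‖x‖ ≤ 1 ∧ 1 - ε < f (tp x y₀) := by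
  have : ProperSpace Y := FiniteDimensional.proper ℝ _
  let B : X →L[ℝ] Y →L[ℝ] Z := tp.mkContinuous₂ 1 fun x y => by
    simpa using htp.norm_tp_le x y
  let g : Y → (X →L[ℝ] ℝ) := fun y => f.comp (B.flip y)
  have hg : ∀ x y, g y x = f (tp x y) := fun x y => rfl
  have hgc : Continuous fun y => ‖g y‖ := by fun_prop
  have hgle : ∀ y, ‖g y‖ ≤ ‖y‖ := fun y => by
    refine (g y).opNorm_le_bound (norm_nonneg _) fun x => ?_
    have h := f.le_of_opNorm_le hf.le (tp x y)
    rw [hg]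
    linarith [htp.norm_tp_le x y]
  obtain ⟨y₀, hy₀, hmax⟩ := (isCompact_closedBall (0 : Y) 1).exists_isMaxOn
    ⟨0, by simp⟩ hgc.continuousOn
  have hy₀1 : ‖y₀‖ ≤ 1 := by simpa using hy₀
  have hle : ‖f‖ ≤ ‖g y₀‖ := by
    refine htp.opNorm_le_s6 f (norm_nonneg _) fun x y => ?_
    obtain rfl | hy := eq_or_ne y 0
    · simp
    have hny : 0 < ‖y‖ := norm_pos_iff.2 hy
    have h1 : ‖g (‖y‖⁻¹ • y)‖ ≤ ‖g y₀‖ := hmax (by simp [norm_smul, hny.ne'])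
    have h2 := (g (‖y‖⁻¹ • y)).le_of_opNorm_le h1 x
    rw [hg, map_smul, map_smul, norm_smul, norm_inv, norm_norm, Real.norm_eq_abs,
      inv_mul_le_iff₀ hny] at h2
    linarith
  rw [hf] at hle
  refine ⟨y₀, le_antisymm hy₀1 (hle.trans (hgle _)), fun ε hε => ?_⟩
  by_contra! hcon
  have hlt : ‖g y₀‖ ≤ max (1 - ε) 0 := by
    refine ContinuousLinearMap.opNorm_le_of_unit_norm (le_max_right _ _) fun x hx => ?_
    refine le_trans ?_ (le_max_left _ _)
    rw [hg, Real.norm_eq_abs, abs_le']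
    refine ⟨hcon x hx.le, ?_⟩
    simpa using hcon (-x) (by simp [hx])
  have : max (1 - ε) 0 < 1 := max_lt (by linarith) one_pos
  linarith

end TensorNorm

section ZeroAtInfty

variable {I : Type*} [TopologicalSpace I]

lemma zeroAtInfty_norm_le {x : ZeroAtInftyContinuousMap I ℝ} {C : ℝ} (hC : 0 ≤ C) :
    ‖x‖ ≤ C ↔ ∀ i, |x i| ≤ C := by
  rw [← ZeroAtInftyContinuousMap.norm_toBCF_eq_norm, BoundedContinuousFunction.norm_le hC]
  rfl

lemma abs_apply_le_zeroAtInfty_norm (x : ZeroAtInftyContinuousMap I ℝ) (i : I) : |x i| ≤ ‖x‖ :=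
  (zeroAtInfty_norm_le (norm_nonneg x)).1 le_rfl i

variable [DiscreteTopology I]

/-- The finitely supported function agreeing with `g` on `F`, as an element of `c₀(I)`. -/
noncomputable def zeroAtInftyTrunc (F : Finset I) (g : I → ℝ) : ZeroAtInftyContinuousMap I ℝ where
  toFun := (F : Set I).indicator g
  continuous_toFun := continuous_of_discreteTopology
  zero_at_infty' := by
    rw [Filter.cocompact_eq_cofinite]
    refine tendsto_const_nhds.congr' ?_
    filter_upwards [F.finite_toSet.compl_mem_cofinite] with i hi
    exact (Set.indicator_of_notMem hi g).symm

lemma zeroAtInftyTrunc_apply (F : Finset I) (g : I → ℝ) (i : I) :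
    zeroAtInftyTrunc F g i = (F : Set I).indicator g i := rfl

lemma norm_zeroAtInftyTrunc_le (F : Finset I) (x : ZeroAtInftyContinuousMap I ℝ) :
    ‖zeroAtInftyTrunc F x‖ ≤ ‖x‖ := by
  refine (zeroAtInfty_norm_le (norm_nonneg x)).2 fun i => ?_
  rw [zeroAtInftyTrunc_apply]
  refine le_trans ?_ (abs_apply_le_zeroAtInfty_norm x i)
  by_cases hi : i ∈ (F : Set I)
  · rw [Set.indicator_of_mem hi]
  · rw [Set.indicator_of_notMem hi, abs_zero]
    exact abs_nonneg _

lemma norm_sub_zeroAtInftyTrunc_le (F : Finset I) (x : ZeroAtInftyContinuousMap I ℝ) :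
    ‖x - zeroAtInftyTrunc F x‖ ≤ ‖x‖ := by
  refine (zeroAtInfty_norm_le (norm_nonneg x)).2 fun i => ?_
  rw [ZeroAtInftyContinuousMap.sub_apply, zeroAtInftyTrunc_apply]
  by_cases hi : i ∈ (F : Set I)
  · simp [hi]
  · simpa [hi] using abs_apply_le_zeroAtInfty_norm x i

lemma exists_norm_sub_zeroAtInftyTrunc_le (x : ZeroAtInftyContinuousMap I ℝ) {ε : ℝ}
    (hε : 0 < ε) : ∃ F : Finset I, ‖x - zeroAtInftyTrunc F x‖ ≤ ε := by
  have h : ∀ᶠ i in Filter.cofinite, |x i| < ε := by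
    have := (zero_at_infty x).norm
    rw [norm_zero, Filter.cocompact_eq_cofinite] at this
    exact this.eventually (gt_mem_nhds hε)
  refine ⟨(Filter.eventually_cofinite.1 h).toFinset, (zeroAtInfty_norm_le hε.le).2 fun i => ?_⟩
  rw [ZeroAtInftyContinuousMap.sub_apply, zeroAtInftyTrunc_apply]
  by_cases hi : |x i| < ε
  · rw [Set.indicator_of_notMem (by simpa using hi), sub_zero]
    exact hi.le
  · rw [Set.indicator_of_mem (by simpa using hi), sub_self, abs_zero]
    exact hε.le

lemma zeroAtInftyTrunc_eq_sum (F : Finset I) (g : I → ℝ) :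
    zeroAtInftyTrunc F g = ∑ i ∈ F, g i • zeroAtInftyTrunc {i} 1 := by
  classical
  ext j
  have h : ∀ s : Finset I, (∑ i ∈ s, g i • zeroAtInftyTrunc {i} 1 : ZeroAtInftyContinuousMap I ℝ) j
      = ∑ i ∈ s, g i * zeroAtInftyTrunc {i} 1 j := fun s => by
    induction s using Finset.induction_on with
    | empty => simp
    | insert a s ha ih => simp [Finset.sum_insert ha, ih]
  simp [h, zeroAtInftyTrunc_apply, Set.indicator_apply]

/-- If `x` is supported in `F` and `x'` vanishes on `F`, both of norm at most one, then so is
their sum. -/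
lemma norm_zeroAtInftyTrunc_add_le (F : Finset I) {x x' : ZeroAtInftyContinuousMap I ℝ}
    (hx : ‖x‖ ≤ 1) (hx' : ‖x'‖ ≤ 1) (h : ∀ i ∈ F, x' i = 0) :
    ‖zeroAtInftyTrunc F x + x'‖ ≤ 1 := by
  refine (zeroAtInfty_norm_le zero_le_one).2 fun i => ?_
  rw [ZeroAtInftyContinuousMap.add_apply, zeroAtInftyTrunc_apply]
  by_cases hi : i ∈ F
  · simpa [hi, h i hi] using (abs_apply_le_zeroAtInfty_norm x i).trans hx
  · simpa [hi] using (abs_apply_le_zeroAtInfty_norm x' i).trans hx'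

end ZeroAtInfty

section KadecKlee

variable {I : Type*} [TopologicalSpace I] [DiscreteTopology I]
  {Y : Type*} [NormedAddCommGroup Y] [NormedSpace ℝ Y] [FiniteDimensional ℝ Y]
  {Z : Type*} [NormedAddCommGroup Z] [NormedSpace ℝ Z] [CompleteSpace Z]
  {tp : ZeroAtInftyContinuousMap I ℝ →ₗ[ℝ] Y →ₗ[ℝ] Z}
  {ι : Type*} {l : Filter ι} {φ : ι → Z →L[ℝ] ℝ} {f : Z →L[ℝ] ℝ}

/-- A net in the dual sphere which converges weak* to a point of the sphere has uniformly small
tails in every fixed direction of `Y`. -/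
lemma exists_finset_eventually_tail_le (hY : SmoothNormedSpace Y)
    (htp : IsProjectiveTensorProduct tp) (hφ : ∀ s, ‖φ s‖ = 1) (hf : ‖f‖ = 1)
    (hlim : ∀ z : Z, Filter.Tendsto (fun s => φ s z) l (𝓝 (f z))) (y : Y) {η : ℝ} (hη : 0 < η) :
    ∃ F : Finset I, ∀ᶠ s in l, ∀ x : ZeroAtInftyContinuousMap I ℝ, ‖x‖ ≤ 1 →
      (∀ i ∈ F, x i = 0) → |φ s (tp x y)| ≤ η := by
  obtain ⟨y₀, hy₀, hnorming⟩ := htp.exists_norming f hf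
  obtain ⟨t, ht, hsmooth⟩ := hY.exists_norm_add_norm_sub_le hy₀ y hη
  have hle : ∀ ψ : Z →L[ℝ] ℝ, ‖ψ‖ = 1 → ∀ x y, ψ (tp x y) ≤ ‖x‖ * ‖y‖ := fun ψ hψ x y => by
    have h := (le_abs_self _).trans (ψ.le_of_opNorm_le hψ.le (tp x y))
    linarith [htp.norm_tp_le x y]
  obtain ⟨x₀, hx₀, hfx₀⟩ := hnorming (η * t / 4) (by positivity)
  obtain ⟨F, hF⟩ := exists_norm_sub_zeroAtInftyTrunc_le x₀ (ε := η * t / 4) (by positivity)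
  have hfF : 1 - η * t / 2 < f (tp (zeroAtInftyTrunc F x₀) y₀) := by
    have h := hle f hf (x₀ - zeroAtInftyTrunc F x₀) y₀
    rw [hy₀, map_sub, LinearMap.sub_apply, map_sub] at h
    linarith
  refine ⟨F, ((hlim _).eventually (lt_mem_nhds hfF)).mono fun s hs => ?_⟩
  have key : ∀ x : ZeroAtInftyContinuousMap I ℝ, ‖x‖ ≤ 1 → (∀ i ∈ F, x i = 0) →
      φ s (tp x y) ≤ η := by
    intro x hx hxF
    have hadd := norm_zeroAtInftyTrunc_add_le F hx₀ hx hxF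
    have hsub := norm_zeroAtInftyTrunc_add_le F hx₀ (x' := -x) (by simpa using hx)
      (by simpa using hxF)
    have h1 := (hle (φ s) (hφ s) _ (y₀ + t • y)).trans
      (mul_le_of_le_one_left (norm_nonneg _) hadd)
    have h2 := (hle (φ s) (hφ s) _ (y₀ - t • y)).trans
      (mul_le_of_le_one_left (norm_nonneg _) hsub)
    simp only [map_add, map_sub, map_neg, map_smul, LinearMap.add_apply, LinearMap.neg_apply,
      smul_eq_mul] at h1 h2
    have : t * φ s (tp x y) ≤ t * η := by linarith
    exact le_of_mul_le_mul_left this ht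
  intro x hx hxF
  refine abs_le'.2 ⟨key x hx hxF, ?_⟩
  simpa using key (-x) (by simpa using hx) (by simpa using hxF)

/-- Such a net converges uniformly on the unit ball of `c₀(I)`, in every fixed direction of
`Y`. -/
lemma eventually_abs_sub_apply_le [l.NeBot] (hY : SmoothNormedSpace Y)
    (htp : IsProjectiveTensorProduct tp) (hφ : ∀ s, ‖φ s‖ = 1) (hf : ‖f‖ = 1)
    (hlim : ∀ z : Z, Filter.Tendsto (fun s => φ s z) l (𝓝 (f z))) (y : Y) {η : ℝ} (hη : 0 < η) :
    ∀ᶠ s in l, ∀ x : ZeroAtInftyContinuousMap I ℝ, ‖x‖ ≤ 1 → |(φ s - f) (tp x y)| ≤ η := by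
  obtain ⟨F, hF⟩ := exists_finset_eventually_tail_le hY htp hφ hf hlim y
    (η := η / 3) (by positivity)
  have hfF : ∀ x : ZeroAtInftyContinuousMap I ℝ, ‖x‖ ≤ 1 → (∀ i ∈ F, x i = 0) →
      |f (tp x y)| ≤ η / 3 := fun x hx hxF =>
    le_of_tendsto (hlim _).abs (hF.mono fun s hs => hs x hx hxF)
  have hsum : Filter.Tendsto (fun s => ∑ i ∈ F, |(φ s - f) (tp (zeroAtInftyTrunc {i} 1) y)|) l
      (𝓝 0) := by
    rw [← Finset.sum_const_zero (s := F)]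
    refine tendsto_finsetSum _ fun i _ => ?_
    simpa using ((hlim (tp (zeroAtInftyTrunc {i} 1) y)).sub_const
      (f (tp (zeroAtInftyTrunc {i} 1) y))).abs
  filter_upwards [hF, hsum.eventually (gt_mem_nhds (show (0 : ℝ) < η / 3 by positivity))]
    with s hs hsF x hx
  have hx1 : ‖x - zeroAtInftyTrunc F x‖ ≤ 1 := (norm_sub_zeroAtInftyTrunc_le F x).trans hx
  have hx2 : ∀ i ∈ F, (x - zeroAtInftyTrunc F x) i = 0 := fun i hi => by
    simp [zeroAtInftyTrunc_apply, hi]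
  have hhead : |(φ s - f) (tp (zeroAtInftyTrunc F x) y)| ≤ η / 3 := by
    refine le_trans ?_ hsF.le
    rw [zeroAtInftyTrunc_eq_sum, map_sum, LinearMap.sum_apply, map_sum]
    refine (Finset.abs_sum_le_sum_abs _ _).trans (Finset.sum_le_sum fun i _ => ?_)
    rw [map_smul, LinearMap.smul_apply, map_smul, smul_eq_mul, abs_mul]
    exact mul_le_of_le_one_left (abs_nonneg _) ((abs_apply_le_zeroAtInfty_norm x i).trans hx)
  have hsplit : (φ s - f) (tp x y) = (φ s - f) (tp (zeroAtInftyTrunc F x) y)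
      + (φ s (tp (x - zeroAtInftyTrunc F x) y) - f (tp (x - zeroAtInftyTrunc F x) y)) := by
    simp only [map_sub, LinearMap.sub_apply, sub_apply]
    ring
  have h1 := hs _ hx1 hx2
  have h2 := hfF _ hx1 hx2
  rw [abs_le] at *
  rw [hsplit]
  constructor <;> linarith

end KadecKlee

/-- **Theorem 3.6** (second statement). Let `I` be an infinite (discrete) set and let `Y` be a
finite-dimensional smooth Banach space. Then `(c₀(I) ⊗̂_π Y)*` has the `w*`-Kadec–Klee
property. -/
theorem wstarKadecKlee_of_projectiveTensorProduct_c0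
    (I : Type*) [TopologicalSpace I] [DiscreteTopology I] [Infinite I]
    (Y : Type*) [NormedAddCommGroup Y] [NormedSpace ℝ Y] [FiniteDimensional ℝ Y]
    (hY : SmoothNormedSpace Y)
    (Z : Type*) [NormedAddCommGroup Z] [NormedSpace ℝ Z] [CompleteSpace Z]
    (tp : ZeroAtInftyContinuousMap I ℝ →ₗ[ℝ] Y →ₗ[ℝ] Z)
    (htp : IsProjectiveTensorProduct tp) :
    WStarKadecKlee Z := by
  intro ι l _ φ f hφ hf hlim
  let b := Module.finBasis ℝ Y
  let c : Fin (Module.finrank ℝ Y) → Y →L[ℝ] ℝ := fun j => (b.coord j).toContinuousLinearMap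
  set M : ℝ := ∑ j, ‖c j‖ with hM
  have hM0 : 0 ≤ M := by positivity
  rw [Metric.tendsto_nhds]
  intro ε hε
  have hδ : 0 < ε / (2 * (M + 1)) := by positivity
  filter_upwards [Filter.eventually_all.2 fun j =>
    eventually_abs_sub_apply_le hY htp hφ hf hlim (b j) hδ] with s hs
  have hscale : ∀ j x, |(φ s - f) (tp x (b j))| ≤ ε / (2 * (M + 1)) * ‖x‖ := by
    intro j x
    obtain rfl | hx := eq_or_ne x 0
    · simp
    have hnx : 0 < ‖x‖ := norm_pos_iff.2 hx
    have h := hs j (‖x‖⁻¹ • x) (by simp [norm_smul, hnx.ne'])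
    rw [map_smul, LinearMap.smul_apply, map_smul, smul_eq_mul, abs_mul, abs_inv, abs_norm,
      inv_mul_le_iff₀ hnx] at h
    linarith
  have hnorm : ‖φ s - f‖ ≤ ε / (2 * (M + 1)) * M := by
    refine htp.opNorm_le_s6 _ (by positivity) fun x y => ?_
    have hy : (φ s - f) (tp x y) = ∑ j, c j y * (φ s - f) (tp x (b j)) := by
      conv_lhs => rw [← b.sum_repr y]
      simp only [map_sum, map_smul, smul_eq_mul]
      rfl
    rw [hy, hM, Finset.mul_sum, Finset.sum_mul]
    refine (Finset.abs_sum_le_sum_abs _ _).trans (Finset.sum_le_sum fun j _ => ?_)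
    rw [abs_mul]
    calc |c j y| * |(φ s - f) (tp x (b j))|
        ≤ (‖c j‖ * ‖y‖) * (ε / (2 * (M + 1)) * ‖x‖) :=
          mul_le_mul ((c j).le_opNorm y) (hscale j x) (abs_nonneg _) (by positivity)
      _ = ε / (2 * (M + 1)) * ‖c j‖ * (‖x‖ * ‖y‖) := by ring
  rw [Real.dist_eq, sub_zero, abs_norm]
  refine hnorm.trans_lt ?_
  rw [div_mul_eq_mul_div, div_lt_iff₀ (by positivity)]
  nlinarith
end
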